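/- For every s ∈ ℂ with Re(s) > n/β, ∫_{ℚ_p^n∖ℤ_p^n} ‖ξ‖_p^{−βs} dⁿξ = (1−p^{−n}) p^{n−βs}/(1−p^{n−βs}); this is the spectral zeta function ζ(s;D_T^β) of the Taibleson operator with symbol ‖ξ‖_p^{β}, and in particular it admits a meromorphic continuation to all of ℂ as a rational function of p^{−s}, with poles exactly at the points s ∈ n/β + (2πi/(β ln p))ℤ. -/

import Mathlib

open MeasureTheory Filter Topology Metric

noncomputable instance qpnMeasurableSpace {p : ℕ} [Fact p.Prime] {n : ℕ} :
    MeasurableSpace (Fin n → ℚ_[p]) := borel _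

instance qpnBorelSpace {p : ℕ} [Fact p.Prime] {n : ℕ} :
    BorelSpace (Fin n → ℚ_[p]) := ⟨rfl⟩

theorem tsz_norm_le_iff {p n : ℕ} [Fact p.Prime] (ξ : Fin n → ℚ_[p]) (k : ℕ) :
    ‖ξ‖ ≤ (p : ℝ) ^ k ↔ ‖ξ‖ < (p : ℝ) ^ (k + 1) := by
  have hp : (0 : ℝ) < p := by exact_mod_cast (Fact.out : p.Prime).pos
  rw [pi_norm_le_iff_of_nonneg (by positivity), pi_norm_lt_iff (by positivity)]
  refine forall_congr' fun i => ?_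
  have := Padic.norm_le_pow_iff_norm_lt_pow_add_one (ξ i) (k : ℤ)
  exact_mod_cast this

theorem tsz_digit {p : ℕ} [Fact p.Prime] (k : ℕ) (x : ℚ_[p]) (hx : ‖x‖ ≤ (p : ℝ) ^ (k + 1)) :
    ∃ a : Fin p, ‖x - ((p : ℚ_[p]) ^ (k + 1))⁻¹ * (a : ℕ)‖ ≤ (p : ℝ) ^ k := by
  have hp : (0 : ℝ) < p := by exact_mod_cast (Fact.out : p.Prime).pos
  have hp' : (p : ℚ_[p]) ≠ 0 := by exact_mod_cast (Fact.out : p.Prime).ne_zero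
  have hy : ‖x * (p : ℚ_[p]) ^ (k + 1)‖ ≤ 1 := by
    rw [norm_mul, norm_pow, Padic.norm_p, inv_pow, ← div_eq_mul_inv]
    exact (div_le_one (by positivity)).2 hx
  obtain ⟨y, hyx⟩ : ∃ y : ℤ_[p], (y : ℚ_[p]) = x * (p : ℚ_[p]) ^ (k + 1) := ⟨⟨_, hy⟩, rfl⟩
  obtain ⟨a, ha, h⟩ := PadicInt.exists_mem_range y
  rw [PadicInt.maximalIdeal_eq_span_p, Ideal.mem_span_singleton, ← PadicInt.norm_lt_one_iff_dvd] at h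
  have h' : ‖x * (p : ℚ_[p]) ^ (k + 1) - (a : ℚ_[p])‖ < 1 := by
    rw [PadicInt.norm_def, PadicInt.coe_sub, PadicInt.coe_natCast, hyx] at h
    exact h
  refine ⟨⟨a, ha⟩, ?_⟩
  have e : x - ((p : ℚ_[p]) ^ (k + 1))⁻¹ * (a : ℚ_[p]) =
      ((p : ℚ_[p]) ^ (k + 1))⁻¹ * (x * (p : ℚ_[p]) ^ (k + 1) - (a : ℚ_[p])) := by
    field_simp
  have h3 := Padic.norm_le_pow_iff_norm_lt_pow_add_one
    (x - ((p : ℚ_[p]) ^ (k + 1))⁻¹ * (a : ℚ_[p])) (k : ℤ)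
  have h4 : ‖x - ((p : ℚ_[p]) ^ (k + 1))⁻¹ * (a : ℚ_[p])‖ < (p : ℝ) ^ (k + 1) := by
    rw [e, norm_mul, norm_inv, norm_pow, Padic.norm_p, inv_pow, inv_inv]
    exact mul_lt_of_lt_one_right (by positivity) h'
  exact_mod_cast h3.2 (by exact_mod_cast h4)

theorem tsz_digit_unique {p : ℕ} [Fact p.Prime] (k : ℕ) (x : ℚ_[p]) (a b : Fin p)
    (ha : ‖x - ((p : ℚ_[p]) ^ (k + 1))⁻¹ * (a : ℕ)‖ ≤ (p : ℝ) ^ k)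
    (hb : ‖x - ((p : ℚ_[p]) ^ (k + 1))⁻¹ * (b : ℕ)‖ ≤ (p : ℝ) ^ k) : a = b := by
  have hp1 : (1 : ℝ) < p := by exact_mod_cast (Fact.out : p.Prime).one_lt
  have hp : (0 : ℝ) < p := by linarith
  have h1 : ‖((p : ℚ_[p]) ^ (k + 1))⁻¹ * (((a : ℕ) : ℤ) - ((b : ℕ) : ℤ) : ℤ)‖ ≤ (p : ℝ) ^ k := by
    have e : ((p : ℚ_[p]) ^ (k + 1))⁻¹ * ((((a : ℕ) : ℤ) - ((b : ℕ) : ℤ) : ℤ) : ℚ_[p]) =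
      (x - ((p : ℚ_[p]) ^ (k + 1))⁻¹ * (b : ℕ)) + -(x - ((p : ℚ_[p]) ^ (k + 1))⁻¹ * (a : ℕ)) := by
      push_cast; ring
    rw [e]
    refine (Padic.nonarchimedean _ _).trans (max_le hb ?_)
    rwa [norm_neg]
  rw [norm_mul, norm_inv, norm_pow, Padic.norm_p, inv_pow, inv_inv] at h1
  have h2 : ‖((((a : ℕ) : ℤ) - ((b : ℕ) : ℤ) : ℤ) : ℚ_[p])‖ < 1 := by
    by_contra hc
    have : (p : ℝ) ^ (k + 1) ≤ (p : ℝ) ^ k :=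
      le_trans (le_mul_of_one_le_right (by positivity) (not_lt.1 hc)) h1
    exact absurd this (not_le.2 (pow_lt_pow_right₀ hp1 (Nat.lt_succ_self k)))
  rw [Padic.norm_intCast_lt_one_iff] at h2
  have h3 := Int.eq_zero_of_abs_lt_dvd h2 (by
    rw [abs_lt]; have := a.2; have := b.2; constructor <;> omega)
  ext; omega

theorem tsz_ball_succ {p n : ℕ} [Fact p.Prime]
    (μ : Measure (Fin n → ℚ_[p])) [μ.IsAddHaarMeasure] (k : ℕ) :
    μ (closedBall (0 : Fin n → ℚ_[p]) ((p : ℝ) ^ (k + 1))) =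
      (p : ENNReal) ^ n * μ (closedBall (0 : Fin n → ℚ_[p]) ((p : ℝ) ^ k)) := by
  have hp1 : (1 : ℝ) < p := by exact_mod_cast (Fact.out : p.Prime).one_lt
  have hp : (0 : ℝ) < p := by linarith
  let c : (Fin n → Fin p) → (Fin n → ℚ_[p]) :=
    fun a i => ((p : ℚ_[p]) ^ (k + 1))⁻¹ * ((a i : ℕ) : ℚ_[p])
  have hmem : ∀ (a : Fin n → Fin p) (x : Fin n → ℚ_[p]),
      x ∈ closedBall (c a) ((p : ℝ) ^ k) ↔
      ∀ i, ‖x i - ((p : ℚ_[p]) ^ (k + 1))⁻¹ * ((a i : ℕ) : ℚ_[p])‖ ≤ (p : ℝ) ^ k := by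
    intro a x
    rw [mem_closedBall, dist_eq_norm, pi_norm_le_iff_of_nonneg (by positivity)]
    rfl
  have hU : closedBall (0 : Fin n → ℚ_[p]) ((p : ℝ) ^ (k + 1)) =
      ⋃ a : Fin n → Fin p, closedBall (c a) ((p : ℝ) ^ k) := by
    ext x
    rw [Set.mem_iUnion, mem_closedBall_zero_iff, pi_norm_le_iff_of_nonneg (by positivity)]
    constructor
    · intro h
      choose a ha using fun i => tsz_digit k (x i) (h i)
      exact ⟨a, (hmem a x).2 ha⟩
    · rintro ⟨a, ha⟩ i
      have h1 := (hmem a x).1 ha i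
      have e : x i = (x i - ((p : ℚ_[p]) ^ (k + 1))⁻¹ * ((a i : ℕ) : ℚ_[p])) +
        ((p : ℚ_[p]) ^ (k + 1))⁻¹ * ((a i : ℕ) : ℚ_[p]) := by ring
      rw [e]
      refine (Padic.nonarchimedean _ _).trans (max_le (h1.trans ?_) ?_)
      · exact pow_le_pow_right₀ hp1.le (Nat.le_succ k)
      · rw [norm_mul, norm_inv, norm_pow, Padic.norm_p, inv_pow, inv_inv]
        have := Padic.norm_int_le_one (p := p) ((a i : ℕ) : ℤ)
        exact mul_le_of_le_one_right (by positivity) (by exact_mod_cast this)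
  rw [hU, measure_iUnion]
  · have : ∀ a, μ (closedBall (c a) ((p : ℝ) ^ k)) =
        μ (closedBall (0 : Fin n → ℚ_[p]) ((p : ℝ) ^ k)) := by
      intro a
      have e : closedBall (0 : Fin n → ℚ_[p]) ((p : ℝ) ^ k) =
          (fun h => c a + h) ⁻¹' closedBall (c a) ((p : ℝ) ^ k) := by
        ext x; simp [dist_eq_norm]
      rw [e, measure_preimage_add]
    simp_rw [this]
    rw [tsum_fintype, Finset.sum_const, nsmul_eq_mul, Finset.card_univ]
    simp
  · intro a b hab
    refine Set.disjoint_left.2 fun x hxa hxb => hab ?_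
    funext i
    exact tsz_digit_unique k (x i) _ _ ((hmem a x).1 hxa i) ((hmem b x).1 hxb i)
  · exact fun a => isClosed_closedBall.measurableSet

theorem tsz_ball {p n : ℕ} [Fact p.Prime]
    (μ : Measure (Fin n → ℚ_[p])) [μ.IsAddHaarMeasure]
    (hμ : μ (closedBall (0 : Fin n → ℚ_[p]) 1) = 1) (k : ℕ) :
    μ (closedBall (0 : Fin n → ℚ_[p]) ((p : ℝ) ^ k)) = (p : ENNReal) ^ (n * k) := by
  induction k with
  | zero => simpa using hμ
  | succ k ih => rw [tsz_ball_succ, ih, ← pow_add]; ring_nf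

theorem tsz_shell_eq {p n : ℕ} [Fact p.Prime] (j : ℕ) :
    {ξ : Fin n → ℚ_[p] | ‖ξ‖ = (p : ℝ) ^ (j + 1)} =
      closedBall 0 ((p : ℝ) ^ (j + 1)) \ closedBall 0 ((p : ℝ) ^ j) := by
  ext ξ
  rw [Set.mem_sdiff, mem_closedBall_zero_iff, mem_closedBall_zero_iff, tsz_norm_le_iff ξ j, not_lt]
  exact le_antisymm_iff

theorem tsz_shell {p n : ℕ} [Fact p.Prime]
    (μ : Measure (Fin n → ℚ_[p])) [μ.IsAddHaarMeasure]
    (hμ : μ (closedBall (0 : Fin n → ℚ_[p]) 1) = 1) (j : ℕ) :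
    MeasurableSet {ξ : Fin n → ℚ_[p] | ‖ξ‖ = (p : ℝ) ^ (j + 1)} ∧
    μ {ξ : Fin n → ℚ_[p] | ‖ξ‖ = (p : ℝ) ^ (j + 1)} ≠ ⊤ ∧
    μ.real {ξ : Fin n → ℚ_[p] | ‖ξ‖ = (p : ℝ) ^ (j + 1)} =
      (p : ℝ) ^ (n * (j + 1)) - (p : ℝ) ^ (n * j) := by
  have hp1 : (1 : ℝ) < p := by exact_mod_cast (Fact.out : p.Prime).one_lt
  rw [tsz_shell_eq]
  have hfin : ∀ k, μ (closedBall (0 : Fin n → ℚ_[p]) ((p : ℝ) ^ k)) ≠ ⊤ := fun k => by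
    rw [tsz_ball μ hμ]; exact ENNReal.pow_ne_top (ENNReal.natCast_ne_top p)
  refine ⟨isClosed_closedBall.measurableSet.diff isClosed_closedBall.measurableSet,
    ne_top_of_le_ne_top (hfin (j + 1)) (measure_mono Set.sdiff_subset), ?_⟩
  rw [measureReal_sdiff (closedBall_subset_closedBall (pow_le_pow_right₀ hp1.le (Nat.le_succ j)))
    isClosed_closedBall.measurableSet (hfin (j + 1))]
  simp [Measure.real, tsz_ball μ hμ]

theorem tsz_iUnion {p n : ℕ} [Fact p.Prime] :
    {ξ : Fin n → ℚ_[p] | 1 < ‖ξ‖} = ⋃ j : ℕ, {ξ | ‖ξ‖ = (p : ℝ) ^ (j + 1)} := by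
  have hp1 : (1 : ℝ) < p := by exact_mod_cast (Fact.out : p.Prime).one_lt
  ext ξ
  rw [Set.mem_iUnion]
  constructor
  · intro h
    obtain ⟨m, h1, h2⟩ := exists_nat_pow_near (le_of_lt h) hp1
    have h3 := le_antisymm ((tsz_norm_le_iff ξ m).2 h2) h1
    cases m with
    | zero => rw [pow_zero] at h3; exact absurd h3 (ne_of_gt h)
    | succ j => exact ⟨j, h3⟩
  · rintro ⟨j, hj⟩
    have hj' : ‖ξ‖ = (p : ℝ) ^ (j + 1) := hj
    show 1 < ‖ξ‖
    rw [hj']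
    exact one_lt_pow₀ hp1 (Nat.succ_ne_zero j)

theorem tsz_integral {p n : ℕ} [Fact p.Prime]
    (μ : Measure (Fin n → ℚ_[p])) [μ.IsAddHaarMeasure]
    (hμ : μ (closedBall (0 : Fin n → ℚ_[p]) 1) = 1)
    (w : ℂ) (hw : (n : ℝ) < w.re) :
    IntegrableOn (fun ξ => (‖ξ‖ : ℂ) ^ (-w)) {ξ : Fin n → ℚ_[p] | 1 < ‖ξ‖} μ ∧
      (∫ ξ in {ξ : Fin n → ℚ_[p] | 1 < ‖ξ‖}, (‖ξ‖ : ℂ) ^ (-w) ∂μ) =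
        (1 - (p : ℂ) ^ (-(n : ℤ))) * (p : ℂ) ^ ((n : ℂ) - w) /
          (1 - (p : ℂ) ^ ((n : ℂ) - w)) := by
  have hp1 : (1 : ℝ) < p := by exact_mod_cast (Fact.out : p.Prime).one_lt
  have hp : (0 : ℝ) < p := by linarith
  have hpc : (p : ℂ) ≠ 0 := by exact_mod_cast hp.ne'
  set r : ℂ := (p : ℂ) ^ ((n : ℂ) - w) with hr
  set q : ℂ := (p : ℂ) ^ (-w) with hq
  have hrq : r = (p : ℂ) ^ n * q := by
    rw [hr, hq, sub_eq_add_neg, Complex.cpow_add _ _ hpc, Complex.cpow_natCast]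
  have hrn : ‖r‖ < 1 := by
    rw [hr, Complex.norm_natCast_cpow_of_pos (Fact.out : p.Prime).pos]
    apply Real.rpow_lt_one_of_one_lt_of_neg hp1
    simpa using hw
  have hval : ∀ j : ℕ, ∀ ξ : Fin n → ℚ_[p], ‖ξ‖ = (p : ℝ) ^ (j + 1) →
      (‖ξ‖ : ℂ) ^ (-w) = q ^ (j + 1) := by
    intro j ξ h
    rw [h, hq]
    push_cast
    rw [← Complex.cpow_nat_mul, ← Complex.natCast_cpow_natCast_mul]
  have hconst : ∀ j : ℕ, ((p : ℝ) ^ (n * (j + 1)) - (p : ℝ) ^ (n * j) : ℂ) * q ^ (j + 1) =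
      (1 - (p : ℂ) ^ (-(n : ℤ))) * r * r ^ j := by
    intro j
    rw [hrq, zpow_neg, zpow_natCast, mul_pow, Complex.ofReal_natCast]
    field_simp
    ring
  have hsh := tsz_shell μ hμ
  have hint : ∀ j : ℕ, IntegrableOn (fun ξ : Fin n → ℚ_[p] => (‖ξ‖ : ℂ) ^ (-w))
      {ξ | ‖ξ‖ = (p : ℝ) ^ (j + 1)} μ := by
    intro j
    refine (integrableOn_congr_fun (fun ξ hξ => hval j ξ hξ) (hsh j).1).2 ?_
    exact integrableOn_const (hsh j).2.1
  have hI : IntegrableOn (fun ξ => (‖ξ‖ : ℂ) ^ (-w)) {ξ : Fin n → ℚ_[p] | 1 < ‖ξ‖} μ := by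
    rw [tsz_iUnion]
    refine integrableOn_iUnion_of_summable_integral_norm hint ?_
    have : ∀ j : ℕ, (∫ ξ in {ξ : Fin n → ℚ_[p] | ‖ξ‖ = (p : ℝ) ^ (j + 1)},
        ‖(‖ξ‖ : ℂ) ^ (-w)‖ ∂μ) = ‖(1 - (p : ℂ) ^ (-(n : ℤ))) * r‖ * ‖r‖ ^ j := by
      intro j
      rw [setIntegral_congr_fun (g := fun _ => ‖q ^ (j + 1)‖) (hsh j).1
        (fun ξ hξ => by simp only [hval j ξ hξ]), setIntegral_const, (hsh j).2.2, smul_eq_mul,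
        ← norm_pow, ← norm_mul, ← hconst, norm_mul]
      congr 1
      rw [← Complex.ofReal_pow, ← Complex.ofReal_pow, ← Complex.ofReal_sub, Complex.norm_real,
        Real.norm_of_nonneg]
      exact sub_nonneg.2 (pow_le_pow_right₀ hp1.le (Nat.mul_le_mul_left n (Nat.le_succ j)))
    simp_rw [this]
    exact (summable_geometric_of_lt_one (norm_nonneg _) hrn).mul_left _
  refine ⟨hI, ?_⟩
  have hI' := hI
  rw [tsz_iUnion] at hI' ⊢
  rw [integral_iUnion (fun j => (hsh j).1) ?_ hI']
  · have : ∀ j : ℕ, (∫ ξ in {ξ : Fin n → ℚ_[p] | ‖ξ‖ = (p : ℝ) ^ (j + 1)},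
        (‖ξ‖ : ℂ) ^ (-w) ∂μ) = (1 - (p : ℂ) ^ (-(n : ℤ))) * r * r ^ j := by
      intro j
      rw [setIntegral_congr_fun (g := fun _ => q ^ (j + 1)) (hsh j).1
        (fun ξ hξ => hval j ξ hξ), setIntegral_const, (hsh j).2.2, Complex.real_smul, ← hconst]
      push_cast
      rfl
    simp_rw [this]
    rw [tsum_mul_left, tsum_geometric_of_norm_lt_one hrn, div_eq_mul_inv]
  · intro i j hij
    refine Set.disjoint_left.2 fun x hi hj => hij ?_
    have h1 : (p : ℝ) ^ (i + 1) = (p : ℝ) ^ (j + 1) := Eq.trans (Eq.symm hi) hj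
    have := pow_right_injective₀ hp (ne_of_gt hp1) h1
    omega

theorem tsz_pole_iff {p n : ℕ} [Fact p.Prime] (β : ℝ) (hβ : 0 < β) (s : ℂ) :
    (p : ℂ) ^ ((n : ℂ) - (β : ℂ) * s) = 1 ↔
    ∃ k : ℤ, s = (n : ℂ) / (β : ℂ) +
        2 * Real.pi * Complex.I * (k : ℂ) / ((β : ℂ) * Real.log p) := by
  have hp1 : (1 : ℝ) < p := by exact_mod_cast (Fact.out : p.Prime).one_lt
  have hpc : (p : ℂ) ≠ 0 := by exact_mod_cast (by linarith : (p : ℝ) ≠ 0)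
  have hb : (β : ℂ) ≠ 0 := by exact_mod_cast hβ.ne'
  have hl : (Real.log p : ℂ) ≠ 0 := by exact_mod_cast (Real.log_pos hp1).ne'
  rw [Complex.cpow_def_of_ne_zero hpc, Complex.exp_eq_one_iff, ← Complex.natCast_log]
  have key : ∀ k : ℤ, (Real.log p : ℂ) * ((n : ℂ) - β * s) = k * (2 * Real.pi * Complex.I) ↔
      s = (n : ℂ) / (β : ℂ) +
        2 * Real.pi * Complex.I * ((-k : ℤ) : ℂ) / ((β : ℂ) * Real.log p) := by
    intro k
    rw [Int.cast_neg]
    generalize (Real.log p : ℂ) = L at hl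
    field_simp
    constructor <;> intro h <;> linear_combination -h
  constructor
  · rintro ⟨k, hk⟩
    exact ⟨-k, (key k).1 hk⟩
  · rintro ⟨k, hk⟩
    exact ⟨-k, (key (-k)).2 (by rwa [neg_neg])⟩

/-- For `Re(s) > n/β`,
`∫_{ℚ_p^n∖ℤ_p^n} ‖ξ‖_p^{−βs} dⁿξ = (1−p^{−n}) p^{n−βs}/(1−p^{n−βs})`; this is the spectral zeta
function of the Taibleson operator, and the right-hand side provides a meromorphic continuation
of it to all of `ℂ`, holomorphic away from, and with poles exactly at, the points
`s ∈ n/β + (2πi/(β ln p))ℤ`. -/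
theorem taibleson_spectral_zeta {p n : ℕ} [Fact p.Prime] (hn : 0 < n)
    (μ : Measure (Fin n → ℚ_[p])) [μ.IsAddHaarMeasure]
    (hμ : μ (closedBall (0 : Fin n → ℚ_[p]) 1) = 1)
    (β : ℝ) (hβ : 0 < β) :
    (∀ s : ℂ, (n : ℝ) / β < s.re →
      IntegrableOn (fun ξ => (‖ξ‖ : ℂ) ^ (-((β : ℂ) * s))) {ξ : Fin n → ℚ_[p] | 1 < ‖ξ‖} μ ∧
      (∫ ξ in {ξ : Fin n → ℚ_[p] | 1 < ‖ξ‖}, (‖ξ‖ : ℂ) ^ (-((β : ℂ) * s)) ∂μ) =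
        (1 - (p : ℂ) ^ (-(n : ℤ))) * (p : ℂ) ^ ((n : ℂ) - (β : ℂ) * s) /
          (1 - (p : ℂ) ^ ((n : ℂ) - (β : ℂ) * s))) ∧
    DifferentiableOn ℂ
      (fun s : ℂ => (1 - (p : ℂ) ^ (-(n : ℤ))) * (p : ℂ) ^ ((n : ℂ) - (β : ℂ) * s) /
        (1 - (p : ℂ) ^ ((n : ℂ) - (β : ℂ) * s)))
      {s : ℂ | ¬ ∃ k : ℤ, s = (n : ℂ) / (β : ℂ) +
        2 * Real.pi * Complex.I * (k : ℂ) / ((β : ℂ) * Real.log p)} ∧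
    (∀ s : ℂ, (∃ k : ℤ, s = (n : ℂ) / (β : ℂ) +
        2 * Real.pi * Complex.I * (k : ℂ) / ((β : ℂ) * Real.log p)) →
      Tendsto
        (fun z : ℂ => ‖(1 - (p : ℂ) ^ (-(n : ℤ))) * (p : ℂ) ^ ((n : ℂ) - (β : ℂ) * z) /
          (1 - (p : ℂ) ^ ((n : ℂ) - (β : ℂ) * z))‖)
        (𝓝[≠] s) atTop) := by
  have hp1 : (1 : ℝ) < p := by exact_mod_cast (Fact.out : p.Prime).one_lt
  have hpc : (p : ℂ) ≠ 0 := by exact_mod_cast (by linarith : (p : ℝ) ≠ 0)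
  have hb : (β : ℂ) ≠ 0 := by exact_mod_cast hβ.ne'
  have hl : (Real.log p : ℂ) ≠ 0 := by exact_mod_cast (Real.log_pos hp1).ne'
  have hder : ∀ z : ℂ, HasDerivAt (fun z : ℂ => (p : ℂ) ^ ((n : ℂ) - (β : ℂ) * z))
      ((p : ℂ) ^ ((n : ℂ) - (β : ℂ) * z) * Complex.log p * (-β)) z := by
    intro z
    have h1 : HasDerivAt (fun z : ℂ => (n : ℂ) - (β : ℂ) * z) (-(β : ℂ)) z := by
      simpa using ((hasDerivAt_id z).const_mul (β : ℂ)).const_sub (n : ℂ)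
    exact h1.const_cpow (Or.inl hpc)
  refine ⟨?_, ?_, ?_⟩
  · intro s hs
    refine tsz_integral μ hμ ((β : ℂ) * s) ?_
    rw [Complex.re_ofReal_mul]
    rw [div_lt_iff₀ hβ] at hs
    linarith
  · intro s hs
    have h1 : 1 - (p : ℂ) ^ ((n : ℂ) - (β : ℂ) * s) ≠ 0 := fun h =>
      hs ((tsz_pole_iff β hβ s).1 (sub_eq_zero.1 h).symm)
    have hd := (hder s).differentiableAt
    exact ((hd.const_mul _).div (hd.const_sub 1) h1).differentiableWithinAt
  · intro s hs
    have h1 := (tsz_pole_iff β hβ s).2 hs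
    have hne : ∀ᶠ z in 𝓝[≠] s, (p : ℂ) ^ ((n : ℂ) - (β : ℂ) * z) ≠ 1 := by
      refine (hder s).eventually_ne ?_
      rw [h1, ← Complex.natCast_log, one_mul]
      exact mul_ne_zero hl (neg_ne_zero.2 hb)
    have hc : Tendsto (fun z : ℂ => (p : ℂ) ^ ((n : ℂ) - (β : ℂ) * z)) (𝓝[≠] s) (𝓝 1) := by
      have := (hder s).continuousAt.tendsto
      rw [h1] at this
      exact this.mono_left nhdsWithin_le_nhds
    have hnum : Tendsto (fun z : ℂ => ‖(1 - (p : ℂ) ^ (-(n : ℤ))) *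
        (p : ℂ) ^ ((n : ℂ) - (β : ℂ) * z)‖) (𝓝[≠] s) (𝓝 ‖(1 - (p : ℂ) ^ (-(n : ℤ))) * 1‖) :=
      (hc.const_mul _).norm
    have hpos : 0 < ‖(1 - (p : ℂ) ^ (-(n : ℤ))) * 1‖ := by
      rw [mul_one, norm_pos_iff, sub_ne_zero, zpow_neg, zpow_natCast]
      intro h
      have h2 : (p : ℂ) ^ n = 1 := by rw [← inv_inv ((p : ℂ) ^ n), ← h, inv_one]
      have h3 : (p : ℝ) ^ n = 1 := by exact_mod_cast h2
      exact absurd h3 (ne_of_gt (one_lt_pow₀ hp1 hn.ne'))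
    have hden : Tendsto (fun z : ℂ => ‖1 - (p : ℂ) ^ ((n : ℂ) - (β : ℂ) * z)‖⁻¹)
        (𝓝[≠] s) atTop := by
      refine Tendsto.inv_tendsto_nhdsGT_zero (tendsto_nhdsWithin_iff.2 ⟨?_, ?_⟩)
      · simpa using (hc.const_sub 1).norm
      · filter_upwards [hne] with z hz
        exact norm_pos_iff.2 (sub_ne_zero.2 (Ne.symm hz))
    refine (hnum.pos_mul_atTop hpos hden).congr fun z => ?_
    rw [norm_div, div_eq_mul_inv]
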